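/- arXiv:cs/0409028 — 8 statements merged into one kernel-verified Lean document; each statement's English description precedes it below -/
import Mathlib

section
/- In a finite market, no bounded price yields a constant nonzero incentive: if π : [0,1] → ℝ is bounded and Lebesgue measurable and there is a constant c ∈ ℝ with (Kπ)(s) = c for all s ∈ (0,1], then c = 0. -/
open MeasureTheory Set

/-- A bounded measurable price divided by the position is integrable away from the origin. -/
theorem intervalIntegrable_div_id {π : ℝ → ℝ} (hmeas : Measurable π) {C : ℝ}
    (hC : ∀ s ∈ Icc (0 : ℝ) 1, |π s| ≤ C) {a : ℝ} (ha : 0 < a) (ha1 : a ≤ 1) :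
    IntervalIntegrable (fun t => π t / t) volume a 1 := by
  rw [intervalIntegrable_iff_integrableOn_Icc_of_le ha1]
  refine Measure.integrableOn_of_bounded (M := C / a) (by simp)
    (hmeas.div measurable_id).aestronglyMeasurable ?_
  filter_upwards [ae_restrict_mem measurableSet_Icc] with t ht
  have h := hC t ⟨ha.le.trans ht.1, ht.2⟩
  rw [Real.norm_eq_abs, abs_div, abs_of_pos (ha.trans_le ht.1)]
  exact div_le_div₀ ((abs_nonneg _).trans h) h ha ht.1

/-- A bounded measurable price with constant incentive `c` satisfies `s * π s = -c`. -/
theorem mul_price_eq_neg_of_constant_incentive {π : ℝ → ℝ} (hmeas : Measurable π) {C : ℝ}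
    (hC : ∀ s ∈ Icc (0 : ℝ) 1, |π s| ≤ C) {c : ℝ}
    (hconst : ∀ s ∈ Ioc (0 : ℝ) 1, (∫ t in s..(1 : ℝ), π t / t) - π s = c)
    {s : ℝ} (hs : s ∈ Ioc (0 : ℝ) 1) : s * π s = -c := by
  set F : ℝ → ℝ := fun s => ∫ t in s..(1 : ℝ), π t / t
  have hF : ∀ x ∈ Ioc (0 : ℝ) 1, π x = F x - c := fun x hx => by
    linarith [hconst x hx]
  have hcontF : ∀ a : ℝ, 0 < a → a ≤ 1 → ContinuousOn F (Icc a 1) := fun a ha ha1 => by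
    have h := (intervalIntegrable_iff_integrableOn_Icc_of_le ha1).mp
      (intervalIntegrable_div_id hmeas hC ha ha1)
    rw [← uIcc_of_le ha1] at h ⊢
    exact intervalIntegral.continuousOn_primitive_interval_left h
  have hderiv : ∀ x ∈ Ioo (0 : ℝ) 1, HasDerivAt F (-(π x / x)) x := fun x hx => by
    have hF_at : ContinuousAt F x := (hcontF (x / 2) (by linarith [hx.1])
      (by linarith [hx.1, hx.2])).continuousAt (Icc_mem_nhds (by linarith [hx.1]) hx.2)
    have hπ_at : ContinuousAt π x := (hF_at.sub continuousAt_const).congr (by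
      filter_upwards [Ioo_mem_nhds hx.1 hx.2] with y hy
      exact (hF y ⟨hy.1, hy.2.le⟩).symm)
    exact intervalIntegral.integral_hasDerivAt_left
      (intervalIntegrable_div_id hmeas hC hx.1 hx.2.le)
      (hmeas.div measurable_id).stronglyMeasurable.stronglyMeasurableAtFilter
      (hπ_at.div continuousAt_id hx.1.ne')
  have hconst_mul := constant_of_has_deriv_right_zero (f := fun x => x * (F x - c))
    (a := s) (b := 1) (continuousOn_id.mul ((hcontF s hs.1 hs.2).sub continuousOn_const))
    (fun x hx => by
      have hx0 : 0 < x := hs.1.trans_le hx.1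
      have h := (hasDerivAt_id x).mul ((hderiv x ⟨hx0, hx.2⟩).sub_const c)
      have hz : 1 * (F x - c) + id x * (-(π x / x)) = 0 := by
        rw [hF x ⟨hx0, hx.2.le⟩, id]
        field_simp
        ring
      rw [hz] at h
      exact h.hasDerivWithinAt) 1 (right_mem_Icc.mpr hs.2)
  rw [hF s hs]
  simpa [F] using hconst_mul.symm

/-- In a finite market, no bounded measurable price yields a constant nonzero incentive:
if `(Kπ)(s) = ∫ₛ¹ π(s')/s' ds' − π(s) = c` for all `s ∈ (0,1]`, then `c = 0`. -/
theorem no_constant_nonzero_incentive (π : ℝ → ℝ) (hmeas : Measurable π)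
    (hbdd : ∃ C : ℝ, ∀ s ∈ Set.Icc (0 : ℝ) 1, |π s| ≤ C)
    (c : ℝ)
    (hconst : ∀ s ∈ Set.Ioc (0 : ℝ) 1, (∫ t in s..(1:ℝ), π t / t) - π s = c) :
    c = 0 := by
  obtain ⟨C, hC⟩ := hbdd
  by_contra hc
  have hC0 : 0 ≤ C := (abs_nonneg _).trans (hC 0 (by simp))
  have hcpos : 0 < |c| := abs_pos.mpr hc
  have hs : |c| / (|c| + C + 1) ∈ Ioc (0 : ℝ) 1 :=
    ⟨by positivity, (div_le_one (by positivity)).mpr (by linarith)⟩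
  have h := congrArg abs (mul_price_eq_neg_of_constant_incentive hmeas hC hconst hs)
  rw [abs_mul, abs_neg, abs_of_pos hs.1] at h
  have hle := mul_le_mul_of_nonneg_left (hC _ ⟨hs.1.le, hs.2⟩) hs.1.le
  rw [h, div_mul_eq_mul_div, le_div_iff₀ (by positivity)] at hle
  nlinarith
end

section
/- Left inversion formula: if π : [0,1] → ℝ is continuously differentiable on [0,1], then for every s ∈ (0,1], −(1/s) ∫₀ˢ σ · (Kπ)'(σ) dσ = π(s), where (Kπ)' denotes the derivative of the incentive v_i = Kπ. In other words, the operator (Ǩv)(s) := −(1/s) ∫₀ˢ σ v'(σ) dσ is a left inverse of K on C¹([0,1]). -/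
open MeasureTheory Set

/-- **Left inversion formula.** If `π` is continuously differentiable on `[0,1]`
(with derivative `π'`), then for every `s ∈ (0,1]`,
`−(1/s) ∫₀ˢ σ · (Kπ)'(σ) dσ = π(s)`, where `(Kπ)'(σ) = −π(σ)/σ − π'(σ)` is the
derivative of the incentive `v_i = Kπ`. -/
theorem left_inversion (π π' : ℝ → ℝ)
    (hderiv : ∀ s ∈ Set.Icc (0 : ℝ) 1, HasDerivWithinAt π (π' s) (Set.Icc (0 : ℝ) 1) s)
    (hcont : ContinuousOn π' (Set.Icc (0 : ℝ) 1)) :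
    ∀ s ∈ Set.Ioc (0 : ℝ) 1,
      -(1 / s) * ∫ σ in (0:ℝ)..s, σ * (-(π σ) / σ - π' σ) = π s := by
  intro s hs
  have hsub : Icc (0 : ℝ) s ⊆ Icc 0 1 := Icc_subset_Icc_right hs.2
  have hπ : ContinuousOn π (Icc 0 s) := fun x hx =>
    (hderiv x (hsub hx)).continuousWithinAt.mono hsub
  have hint : IntervalIntegrable (fun σ => -(π σ + σ * π' σ)) volume 0 s := by
    apply ContinuousOn.intervalIntegrable
    rw [uIcc_of_le hs.1.le]
    exact (hπ.add (continuousOn_id.mul (hcont.mono hsub))).neg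
  have hFTC : ∫ σ in (0 : ℝ)..s, -(π σ + σ * π' σ) = -(s * π s) - -(0 * π 0) := by
    refine intervalIntegral.integral_eq_sub_of_hasDerivAt_of_le
      (f := fun σ => -(σ * π σ)) hs.1.le (continuousOn_id.mul hπ).neg (fun x hx => ?_) hint
    have hx' : HasDerivAt π (π' x) x :=
      (hderiv x (hsub (Ioo_subset_Icc_self hx))).hasDerivAt
        (Icc_mem_nhds hx.1 (hx.2.trans_le hs.2))
    have h := ((hasDerivAt_id x).mul hx').neg
    simp only [id, one_mul] at h
    exact h
  have hcongr : ∫ σ in (0 : ℝ)..s, σ * (-(π σ) / σ - π' σ) =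
      ∫ σ in (0 : ℝ)..s, -(π σ + σ * π' σ) := by
    refine intervalIntegral.integral_congr_ae (Filter.Eventually.of_forall fun x hx => ?_)
    rw [uIoc_of_le hs.1.le] at hx
    have : x ≠ 0 := hx.1.ne'
    field_simp
    ring
  have : s ≠ 0 := hs.1.ne'
  rw [hcongr, hFTC]
  field_simp
  ring
end

section
/- Representation of the price by the incentive: if π : [0,1] → ℝ is continuously differentiable on [0,1] and v_i = Kπ, then for every s ∈ (0,1], π(s) = (1/s) ∫₀ˢ v_i(σ) dσ − v_i(s), where the integral ∫₀ˢ v_i(σ) dσ exists as an improper integral (v_i has at most a logarithmic singularity at 0). -/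
open MeasureTheory Set

lemma intervalIntegrable_div_of_continuous {p : ℝ → ℝ} (hp : Continuous p) {a b : ℝ}
    (ha : 0 < a) (hb : 0 < b) : IntervalIntegrable (fun t => p t / t) volume a b := by
  refine ContinuousOn.intervalIntegrable (hp.continuousOn.div continuousOn_id fun t ht => ?_)
  exact ((lt_min ha hb).trans_le ht.1).ne'

lemma hasDerivAt_integral_div_left {p : ℝ → ℝ} (hp : Continuous p) {x : ℝ} (hx : 0 < x) :
    HasDerivAt (fun σ => ∫ t in σ..(1 : ℝ), p t / t) (-(p x / x)) x := by
  refine intervalIntegral.integral_hasDerivAt_left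
    (intervalIntegrable_div_of_continuous hp hx one_pos)
    (hp.measurable.div measurable_id).stronglyMeasurable.stronglyMeasurableAtFilter ?_
  exact hp.continuousAt.div continuousAt_id hx.ne'

lemma abs_integral_div_le {p : ℝ → ℝ} {M : ℝ}
    (hM : ∀ x ∈ Icc (0 : ℝ) 1, |p x| ≤ M) {x : ℝ} (hx : x ∈ Ioc (0 : ℝ) 1) :
    |∫ t in x..(1 : ℝ), p t / t| ≤ M * |Real.log x| := by
  have h := intervalIntegral.norm_integral_le_of_norm_le (f := fun t => p t / t)
    (g := fun t => M * t⁻¹) (μ := volume) hx.2 (.of_forall fun t ht => ?_) ?_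
  · rw [intervalIntegral.integral_const_mul, integral_inv_of_pos hx.1 one_pos] at h
    simpa [abs_of_nonpos (Real.log_nonpos hx.1.le hx.2)] using h
  · have ht0 : 0 < t := hx.1.trans ht.1
    rw [Real.norm_eq_abs, abs_div, abs_of_pos ht0, div_eq_mul_inv]
    exact mul_le_mul_of_nonneg_right (hM t ⟨ht0.le, ht.2⟩) (inv_nonneg.2 ht0.le)
  · refine (intervalIntegral.intervalIntegrable_inv (fun t ht => ?_) continuousOn_id).const_mul M
    rw [uIcc_of_le hx.2] at ht
    exact (hx.1.trans_le ht.1).ne'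

/-- The incentive has at most a logarithmic singularity at `0`, hence is integrable there. -/
lemma intervalIntegrable_incentive {p : ℝ → ℝ} (hp : Continuous p) {s : ℝ}
    (hs : s ∈ Ioc (0 : ℝ) 1) :
    IntervalIntegrable (fun σ => (∫ t in σ..(1 : ℝ), p t / t) - p σ) volume 0 s := by
  obtain ⟨M, hM⟩ := isCompact_Icc.exists_bound_of_continuousOn (hp.continuousOn (s := Icc 0 1))
  refine IntervalIntegrable.sub ?_ (hp.intervalIntegrable _ _)
  have hlog : IntervalIntegrable (fun σ => M * |Real.log σ|) volume 0 s :=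
    intervalIntegral.intervalIntegrable_log'.abs.const_mul M
  refine hlog.mono_fun' ?_ ?_ <;> rw [uIoc_of_le hs.1.le]
  · refine ContinuousOn.aestronglyMeasurable (fun x hx => ?_) measurableSet_Ioc
    exact (hasDerivAt_integral_div_left hp hx.1).continuousAt.continuousWithinAt
  · filter_upwards [ae_restrict_mem measurableSet_Ioc] with x hx
    exact abs_integral_div_le hM ⟨hx.1, hx.2.trans hs.2⟩

lemma integral_incentive {p : ℝ → ℝ} (hp : Continuous p) {s : ℝ} (hs : s ∈ Ioc (0 : ℝ) 1) :
    ∫ σ in (0 : ℝ)..s, ((∫ t in σ..(1 : ℝ), p t / t) - p σ)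
      = s * ∫ t in s..(1 : ℝ), p t / t := by
  obtain ⟨M, hM⟩ := isCompact_Icc.exists_bound_of_continuousOn (hp.continuousOn (s := Icc 0 1))
  have hd : ∀ x, 0 < x → HasDerivAt (fun σ => σ * ∫ t in σ..(1 : ℝ), p t / t)
      ((∫ t in x..(1 : ℝ), p t / t) - p x) x := fun x hx => by
    refine ((hasDerivAt_id x).mul (hasDerivAt_integral_div_left hp hx)).congr_deriv ?_
    simp only [id]
    field_simp
    ring
  have hc : ContinuousOn (fun σ => σ * ∫ t in σ..(1 : ℝ), p t / t) (Icc 0 s) := by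
    intro x hx
    rcases hx.1.eq_or_lt with rfl | hx0
    · rw [ContinuousWithinAt, zero_mul]
      have hlim : Filter.Tendsto (fun σ : ℝ => M * |σ * Real.log σ|) (nhdsWithin 0 (Icc 0 s))
          (nhds 0) := by
        have h : Continuous fun σ : ℝ => M * |σ * Real.log σ| :=
          continuous_const.mul Real.continuous_mul_log.abs
        simpa using (h.tendsto 0).mono_left nhdsWithin_le_nhds
      refine squeeze_zero_norm' ?_ hlim
      filter_upwards [self_mem_nhdsWithin] with σ hσ
      rcases hσ.1.eq_or_lt with rfl | h0
      · simp
      · rw [Real.norm_eq_abs, abs_mul, abs_mul, mul_left_comm]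
        exact mul_le_mul_of_nonneg_left
          (abs_integral_div_le hM ⟨h0, hσ.2.trans hs.2⟩) (abs_nonneg σ)
    · exact (hd x hx0).continuousAt.continuousWithinAt
  rw [intervalIntegral.integral_eq_sub_of_hasDerivAt_of_le hs.1.le hc
    (fun x hx => hd x hx.1) (intervalIntegrable_incentive hp hs), zero_mul, sub_zero]

/-- **Representation of the price by the incentive.** If `π` is continuously
differentiable on `[0,1]` and `v_i = Kπ`, i.e. `v_i(σ) = ∫_σ¹ π(t)/t dt − π(σ)`,
then `v_i` is (improperly) integrable on `(0,s)` and
`π(s) = (1/s) ∫₀ˢ v_i(σ) dσ − v_i(s)` for all `s ∈ (0,1]`. -/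
theorem price_from_incentive (π π' : ℝ → ℝ)
    (hderiv : ∀ s ∈ Set.Icc (0 : ℝ) 1, HasDerivWithinAt π (π' s) (Set.Icc (0 : ℝ) 1) s)
    (hcont : ContinuousOn π' (Set.Icc (0 : ℝ) 1)) :
    ∀ s ∈ Set.Ioc (0 : ℝ) 1,
      IntervalIntegrable (fun σ => (∫ t in σ..(1:ℝ), π t / t) - π σ) volume 0 s ∧
      π s = (1 / s) * (∫ σ in (0:ℝ)..s, ((∫ t in σ..(1:ℝ), π t / t) - π σ))
              - ((∫ t in s..(1:ℝ), π t / t) - π s) := by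
  intro s hs
  have hπ : ContinuousOn π (Icc 0 1) := fun x hx => (hderiv x hx).continuousWithinAt
  set p : ℝ → ℝ := IccExtend zero_le_one ((Icc (0 : ℝ) 1).domRestrict π)
  have hp : Continuous p := hπ.domRestrict.Icc_extend'
  have hpπ : ∀ x ∈ Icc (0 : ℝ) 1, p x = π x := fun x hx => IccExtend_of_mem _ _ hx
  have hG : ∀ x ∈ Ioc (0 : ℝ) 1, ∫ t in x..(1 : ℝ), p t / t = ∫ t in x..(1 : ℝ), π t / t := by
    intro x hx
    refine intervalIntegral.integral_congr fun t ht => ?_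
    rw [uIcc_of_le hx.2] at ht
    simp only [hpπ t ⟨hx.1.le.trans ht.1, ht.2⟩]
  have hv : EqOn (fun σ => (∫ t in σ..(1 : ℝ), p t / t) - p σ)
      (fun σ => (∫ t in σ..(1 : ℝ), π t / t) - π σ) (uIoc 0 s) := by
    intro x hx
    rw [uIoc_of_le hs.1.le] at hx
    have hx1 : x ≤ 1 := hx.2.trans hs.2
    simp only [hG x ⟨hx.1, hx1⟩, hpπ x ⟨hx.1.le, hx1⟩]
  refine ⟨(intervalIntegrable_incentive hp hs).congr hv, ?_⟩
  rw [← intervalIntegral.integral_congr_ae (.of_forall hv), integral_incentive hp hs, hG s hs,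
    one_div, inv_mul_cancel_left₀ hs.1.ne', sub_sub_cancel]
end

section
/- Monotone decreasing incentives give nonnegative prices: let π : [0,1] → ℝ be continuously differentiable on [0,1] and set v_i = Kπ. If v_i is monotone nonincreasing on (0,1], then π(s) ≥ 0 for all s ∈ (0,1]; if v_i is strictly decreasing on (0,1], then π(s) > 0 for all s ∈ (0,1]. -/
open MeasureTheory Set

/-- The integrand of the incentive operator is continuous away from `0`. -/
lemma continuousOn_div_id_Ioc {f : ℝ → ℝ} (hf : ContinuousOn f (Icc 0 1)) :
    ContinuousOn (fun t => f t / t) (Ioc 0 1) :=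
  (hf.mono Ioc_subset_Icc_self).div continuousOn_id fun _ ht => ht.1.ne'

lemma intervalIntegrable_div_id_s7 {f : ℝ → ℝ} (hf : ContinuousOn f (Icc 0 1)) {a b : ℝ}
    (ha : a ∈ Ioc (0 : ℝ) 1) (hb : b ∈ Ioc (0 : ℝ) 1) :
    IntervalIntegrable (fun t => f t / t) volume a b :=
  ((continuousOn_div_id_Ioc hf).mono (ordConnected_Ioc.uIcc_subset ha hb)).intervalIntegrable

lemma hasDerivAt_incentive {f : ℝ → ℝ} {f' s : ℝ} (hf : ContinuousOn f (Icc 0 1))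
    (hs : s ∈ Ioo (0 : ℝ) 1) (hd : HasDerivAt f f' s) :
    HasDerivAt (fun σ => (∫ t in σ..(1 : ℝ), f t / t) - f σ) (-(f s / s) - f') s := by
  have hcont : ContinuousOn (fun t => f t / t) (Ioo 0 1) :=
    (continuousOn_div_id_Ioc hf).mono Ioo_subset_Ioc_self
  exact (intervalIntegral.integral_hasDerivAt_left
    (intervalIntegrable_div_id_s7 hf ⟨hs.1, hs.2.le⟩ ⟨one_pos, le_rfl⟩)
    (hcont.stronglyMeasurableAtFilter isOpen_Ioo s hs)
    (hcont.continuousAt (isOpen_Ioo.mem_nhds hs))).sub hd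

/-- If the incentive is nonincreasing then revenue `s * f s` is nondecreasing. -/
lemma monotoneOn_mul_of_antitoneOn_incentive {f f' : ℝ → ℝ}
    (hd : ∀ s ∈ Ioo (0 : ℝ) 1, HasDerivAt f (f' s) s) (hf : ContinuousOn f (Icc 0 1))
    (hv : AntitoneOn (fun σ => (∫ t in σ..(1 : ℝ), f t / t) - f σ) (Ioc (0 : ℝ) 1)) :
    MonotoneOn (fun s => s * f s) (Icc 0 1) := by
  have hW : ∀ s ∈ Ioo (0 : ℝ) 1, HasDerivAt (fun s => s * f s) (1 * f s + s * f' s) s :=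
    fun s hs => (hasDerivAt_id s).mul (hd s hs)
  refine monotoneOn_of_deriv_nonneg (convex_Icc 0 1) (continuousOn_id.mul hf) ?_ ?_ <;>
    rw [interior_Icc]
  · exact fun s hs => (hW s hs).differentiableAt.differentiableWithinAt
  · intro s hs
    have hle : -(f s / s) - f' s ≤ 0 := by
      rw [← ((hasDerivAt_incentive hf hs (hd s hs)).hasDerivWithinAt (s := Ioc 0 1)).derivWithin
        (uniqueDiffOn_Ioc 0 1 s ⟨hs.1, hs.2.le⟩)]
      exact hv.derivWithin_nonpos
    rw [(hW s hs).deriv]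
    have hmul := mul_nonneg hs.1.le (neg_nonneg.2 hle)
    have heq : s * (f s / s) = f s := by field_simp [hs.1.ne']
    linarith

/-- **Monotone decreasing incentives give nonnegative prices.** Let `π` be continuously
differentiable on `[0,1]` and `v_i = Kπ`, `v_i(σ) = ∫_σ¹ π(t)/t dt − π(σ)`. If `v_i` is
monotone nonincreasing on `(0,1]` then `π ≥ 0` there; if `v_i` is strictly decreasing
on `(0,1]` then `π > 0` there. -/
theorem antitone_incentive_nonneg_price (π π' : ℝ → ℝ)
    (hderiv : ∀ s ∈ Set.Icc (0 : ℝ) 1, HasDerivWithinAt π (π' s) (Set.Icc (0 : ℝ) 1) s)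
    (hcont : ContinuousOn π' (Set.Icc (0 : ℝ) 1)) :
    (AntitoneOn (fun σ => (∫ t in σ..(1:ℝ), π t / t) - π σ) (Set.Ioc (0 : ℝ) 1) →
      ∀ s ∈ Set.Ioc (0 : ℝ) 1, 0 ≤ π s) ∧
    (StrictAntiOn (fun σ => (∫ t in σ..(1:ℝ), π t / t) - π σ) (Set.Ioc (0 : ℝ) 1) →
      ∀ s ∈ Set.Ioc (0 : ℝ) 1, 0 < π s) := by
  have hπ : ContinuousOn π (Icc 0 1) := fun s hs => (hderiv s hs).continuousWithinAt
  have hd : ∀ s ∈ Ioo (0 : ℝ) 1, HasDerivAt π (π' s) s := fun s hs =>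
    (hderiv s (Ioo_subset_Icc_self hs)).hasDerivAt (Icc_mem_nhds hs.1 hs.2)
  have hnonneg : AntitoneOn (fun σ => (∫ t in σ..(1:ℝ), π t / t) - π σ) (Ioc (0 : ℝ) 1) →
      ∀ s ∈ Ioc (0 : ℝ) 1, 0 ≤ π s := by
    intro hv s hs
    have h := monotoneOn_mul_of_antitoneOn_incentive hd hπ hv
      (left_mem_Icc.2 zero_le_one) (Ioc_subset_Icc_self hs) hs.1.le
    simp only [zero_mul] at h
    exact nonneg_of_mul_nonneg_right h hs.1
  refine ⟨hnonneg, fun hv s hs => (hnonneg hv.antitoneOn s hs).lt_of_ne' fun h0 => ?_⟩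
  have hzero : ∀ t ∈ Ioc 0 s, π t = 0 := by
    intro t ht
    have ht1 : t ∈ Ioc (0 : ℝ) 1 := ⟨ht.1, ht.2.trans hs.2⟩
    have h := monotoneOn_mul_of_antitoneOn_incentive hd hπ hv.antitoneOn
      (Ioc_subset_Icc_self ht1) (Ioc_subset_Icc_self hs) ht.2
    simp only [h0, mul_zero] at h
    exact le_antisymm (nonpos_of_mul_nonpos_right h ht.1) (hnonneg hv.antitoneOn t ht1)
  have hs0 := hs.1
  have hhalf : s / 2 ∈ Ioc (0 : ℝ) 1 := ⟨by linarith, by linarith [hs.2]⟩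
  have hint : ∫ t in (s / 2)..s, π t / t = 0 := by
    refine intervalIntegral.integral_zero_ae (Filter.Eventually.of_forall fun t ht => ?_)
    rw [uIoc_of_le (by linarith)] at ht
    rw [hzero t ⟨by linarith [ht.1], ht.2⟩, zero_div]
  have hlt := hv hhalf hs (by linarith)
  have hadd := intervalIntegral.integral_add_adjacent_intervals
    (intervalIntegrable_div_id_s7 hπ hhalf hs)
    (intervalIntegrable_div_id_s7 hπ hs ⟨one_pos, le_rfl⟩)
  have hhalf0 := hzero (s / 2) ⟨by linarith, by linarith⟩
  simp only [h0, hhalf0] at hlt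
  linarith
end

section
/- Continuum approximation error for constant prices: fix an integer n ≥ 1 and a constant price c ≥ 0. The incentive of the continuous model at saturation s is v_i(s) = −c·ln s − c, and the expected incentive of the k-th market entrant (1 ≤ k ≤ n) in the discrete model is v̄_i(k) = c·( Σ_{k'=k+1}^{n} 1/(k'−1) − 1 ) = c·(H_{n−1} − H_{k−1} − 1). Then for all integers 1 ≤ k ≤ n, | v_i(k/n) − v̄_i(k) | ≤ c·( 1/(2k) + 1/(2n) + 1/(12k²) + 1/(12n²) ). -/
/-- The first two terms of the series of `log (1 + 1/a)` in powers of `1 / (2a + 1)`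
bound it from below. -/
lemma two_terms_le_log_one_add_inv {a : ℝ} (ha : 0 < a) :
    2 / (2 * a + 1) + 2 / (3 * (2 * a + 1) ^ 3) ≤ Real.log (1 + a⁻¹) := by
  have h := sum_le_hasSum (Finset.range 2) (fun i _ => by positivity)
    (Real.hasSum_log_one_add_inv ha)
  refine le_trans (le_of_eq ?_) h
  norm_num [Finset.sum_range_succ]
  field_simp

lemma log_add_one_sub_log_le {a : ℝ} (ha : 0 < a) : Real.log (a + 1) - Real.log a ≤ 1 / a := by
  rw [← Real.log_div (by positivity) ha.ne']
  refine (Real.log_le_sub_one_of_pos (by positivity)).trans_eq ?_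
  field_simp
  ring

lemma le_log_add_one_sub_log {a : ℝ} (ha : 0 < a) :
    1 / a + (1 / (2 * (a + 1)) + 1 / (12 * (a + 1) ^ 2)) - (1 / (2 * a) + 1 / (12 * a ^ 2)) ≤
      Real.log (a + 1) - Real.log a := by
  have h := two_terms_le_log_one_add_inv ha
  have hlog : Real.log (1 + a⁻¹) = Real.log (a + 1) - Real.log a := by
    rw [← Real.log_div (by positivity) ha.ne']
    congr 1
    field_simp
  rw [← hlog]
  refine le_trans (sub_nonneg.mp ?_) h
  have key : 2 / (2 * a + 1) + 2 / (3 * (2 * a + 1) ^ 3) -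
      (1 / a + (1 / (2 * (a + 1)) + 1 / (12 * (a + 1) ^ 2)) -
        (1 / (2 * a) + 1 / (12 * a ^ 2))) =
      (2 * a ^ 2 + 2 * a + 1) / (12 * a ^ 2 * (a + 1) ^ 2 * (2 * a + 1) ^ 3) := by
    field_simp
    ring
  rw [key]
  positivity

/-- Bounds between two values of the sequence `m ↦ H_{m-1} - log m`. -/
lemma harmonic_sub_log_bounds {k n : ℕ} (hk : 1 ≤ k) (hkn : k ≤ n) :
    0 ≤ ((harmonic (n - 1) : ℝ) - Real.log n) - ((harmonic (k - 1) : ℝ) - Real.log k) ∧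
      ((harmonic (n - 1) : ℝ) - Real.log n) - ((harmonic (k - 1) : ℝ) - Real.log k) ≤
        (1 / (2 * (k : ℝ)) + 1 / (12 * (k : ℝ) ^ 2)) -
          (1 / (2 * (n : ℝ)) + 1 / (12 * (n : ℝ) ^ 2)) := by
  induction n, hkn using Nat.le_induction with
  | base => simp
  | succ m hm ih =>
    have hpos : (0 : ℝ) < m := by exact_mod_cast hk.trans hm
    have hstep : (harmonic (m + 1 - 1) : ℝ) = harmonic (m - 1) + 1 / (m : ℝ) := by
      obtain ⟨j, rfl⟩ : ∃ j, m = j + 1 := ⟨m - 1, by omega⟩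
      simp [harmonic_succ]
    have hupper := log_add_one_sub_log_le hpos
    have hlower := le_log_add_one_sub_log hpos
    rw [hstep]
    push_cast
    constructor <;> linarith [ih.1, ih.2]

/-- **Continuum approximation error for constant prices.** For the constant price `c ≥ 0`,
the continuous incentive is `v_i(s) = −c·ln s − c` and the discrete expected incentive of
the `k`-th of `n` market entrants is `v̄_i(k) = c·(H_{n−1} − H_{k−1} − 1)`. Their
difference at `s = k/n` obeys
`|v_i(k/n) − v̄_i(k)| ≤ c·(1/(2k) + 1/(2n) + 1/(12k²) + 1/(12n²))`. -/
theorem continuum_approximation_error (n : ℕ) (hn : 1 ≤ n) (c : ℝ) (hc : 0 ≤ c) :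
    ∀ k : ℕ, 1 ≤ k → k ≤ n →
      |(-c * Real.log ((k : ℝ) / (n : ℝ)) - c) -
          (c * ((harmonic (n - 1) : ℝ) - (harmonic (k - 1) : ℝ) - 1))| ≤
        c * (1 / (2 * (k : ℝ)) + 1 / (2 * (n : ℝ)) +
             1 / (12 * (k : ℝ) ^ 2) + 1 / (12 * (n : ℝ) ^ 2)) := by
  intro k hk hkn
  have hkpos : (0 : ℝ) < k := by exact_mod_cast hk
  have hnpos : (0 : ℝ) < n := by exact_mod_cast hn
  obtain ⟨hlower, hupper⟩ := harmonic_sub_log_bounds hk hkn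
  have hnterm : 0 ≤ 1 / (2 * (n : ℝ)) + 1 / (12 * (n : ℝ) ^ 2) := by positivity
  have hkterm : 0 ≤ 1 / (2 * (k : ℝ)) + 1 / (12 * (k : ℝ) ^ 2) := by positivity
  have hfactor : (-c * Real.log ((k : ℝ) / (n : ℝ)) - c) -
      (c * ((harmonic (n - 1) : ℝ) - (harmonic (k - 1) : ℝ) - 1)) =
      c * (((harmonic (k - 1) : ℝ) - Real.log k) - ((harmonic (n - 1) : ℝ) - Real.log n)) := by
    rw [Real.log_div hkpos.ne' hnpos.ne']
    ring
  rw [hfactor, abs_mul, abs_of_nonneg hc]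
  refine mul_le_mul_of_nonneg_left (abs_le.mpr ⟨?_, ?_⟩) hc <;> linarith
end

section
/- Inversion with constant commission: let γ ∈ (0,1] be a constant and π : [0,1] → ℝ continuously differentiable on [0,1]. Define the commission incentive operator (K_γπ)(s) = ∫ₛ¹ γ·π(s')/s' ds' − π(s) for s ∈ (0,1]. Then K_γπ is continuously differentiable on (0,1] and for every s ∈ (0,1], −s^{−γ} ∫₀ˢ (K_γπ)'(σ) · σ^{γ} dσ = π(s). -/
open MeasureTheory Set

lemma hasDerivWithinAt_integral_left_of_continuousOn_Ioc {g : ℝ → ℝ}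
    (hg : ContinuousOn g (Ioc 0 1)) {s : ℝ} (hs : s ∈ Ioc (0 : ℝ) 1) :
    HasDerivWithinAt (fun u => ∫ t in u..(1 : ℝ), g t) (-g s) (Ioc 0 1) s := by
  obtain ⟨h0, h1⟩ := hs
  have hsub : Icc (s / 2) 1 ⊆ Ioc (0 : ℝ) 1 := fun x hx => ⟨by linarith [hx.1], hx.2⟩
  have hmem : s ∈ Icc (s / 2) 1 := ⟨by linarith, h1⟩
  have hg' := hg.mono hsub
  have : Fact (s ∈ Icc (s / 2) 1) := ⟨hmem⟩
  have hint : IntervalIntegrable g volume s 1 := by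
    apply ContinuousOn.intervalIntegrable
    rw [uIcc_of_le h1]
    exact hg'.mono (Icc_subset_Icc_left hmem.1)
  have hderiv : HasDerivWithinAt (fun u => ∫ t in u..(1 : ℝ), g t) (-g s) (Icc (s / 2) 1) s :=
    intervalIntegral.integral_hasDerivWithinAt_left hint
      (hg'.stronglyMeasurableAtFilter_nhdsWithin measurableSet_Icc s) (hg' s hmem)
  refine hderiv.mono_of_mem_nhdsWithin ?_
  filter_upwards [self_mem_nhdsWithin, mem_nhdsWithin_of_mem_nhds (Ioi_mem_nhds (half_lt_self h0))]
    with x hx hx'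
  exact ⟨le_of_lt hx', hx.2⟩

lemma integral_commission_mul_rpow {γ : ℝ} (hγ : 0 < γ) {f f' : ℝ → ℝ} {s : ℝ} (hs : 0 ≤ s)
    (hf : ContinuousOn f (Icc 0 s)) (hderiv : ∀ x ∈ Ioo 0 s, HasDerivAt f (f' x) x)
    (hf' : ContinuousOn f' (Icc 0 s)) :
    ∫ x in (0 : ℝ)..s, (-(γ * f x) / x - f' x) * x ^ γ = -(s ^ γ * f s) := by
  have hpow : ContinuousOn (fun x : ℝ => x ^ γ) (Icc 0 s) :=
    (Real.continuous_rpow_const hγ.le).continuousOn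
  have hsplit : ∀ x : ℝ, 0 < x →
      -(γ * f x * x ^ (γ - 1) + f' x * x ^ γ) = (-(γ * f x) / x - f' x) * x ^ γ := by
    intro x hx
    rw [Real.rpow_sub_one hx.ne']
    field_simp
    ring
  have hint : IntervalIntegrable (fun x => (-(γ * f x) / x - f' x) * x ^ γ) volume 0 s := by
    have h1 : IntervalIntegrable (fun x => γ * f x * x ^ (γ - 1)) volume 0 s := by
      apply (intervalIntegral.intervalIntegrable_rpow' (by linarith)).continuousOn_mul
      rw [uIcc_of_le hs]
      exact hf.const_mul γ
    have h2 : IntervalIntegrable (fun x => f' x * x ^ γ) volume 0 s := by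
      apply ContinuousOn.intervalIntegrable
      rw [uIcc_of_le hs]
      exact hf'.mul hpow
    refine (h1.add h2).neg.congr ?_
    intro x hx
    rw [uIoc_of_le hs] at hx
    exact hsplit x hx.1
  rw [intervalIntegral.integral_eq_sub_of_hasDerivAt_of_le hs (f := fun x => -(x ^ γ * f x))
    (hpow.mul hf).neg ?_ hint]
  · simp [Real.zero_rpow hγ.ne']
  · intro x hx
    rw [← hsplit x hx.1]
    exact ((Real.hasDerivAt_rpow_const (p := γ) (Or.inl hx.1.ne')).mul 
      (hderiv x hx)).neg.congr_deriv (by ring)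

/-- **Inversion with constant commission.** For a constant commission factor
`γ ∈ (0,1]` and `π` continuously differentiable on `[0,1]`, the commission incentive
`(K_γπ)(s) = ∫ₛ¹ γ·π(t)/t dt − π(s)` is continuously differentiable on `(0,1]`
(with derivative `−γπ(s)/s − π'(s)`) and
`−s^(−γ) ∫₀ˢ (K_γπ)'(σ)·σ^γ dσ = π(s)` for all `s ∈ (0,1]`. -/
theorem inversion_constant_commission (γ : ℝ) (hγ : γ ∈ Set.Ioc (0 : ℝ) 1)
    (π π' : ℝ → ℝ)
    (hderiv : ∀ s ∈ Set.Icc (0 : ℝ) 1, HasDerivWithinAt π (π' s) (Set.Icc (0 : ℝ) 1) s)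
    (hcont : ContinuousOn π' (Set.Icc (0 : ℝ) 1)) :
    (∀ s ∈ Set.Ioc (0 : ℝ) 1,
        HasDerivWithinAt (fun s => (∫ t in s..(1:ℝ), γ * π t / t) - π s)
          (-(γ * π s) / s - π' s) (Set.Ioc (0 : ℝ) 1) s) ∧
    (∀ s ∈ Set.Ioc (0 : ℝ) 1,
        -(s ^ (-γ)) * ∫ σ in (0:ℝ)..s, (-(γ * π σ) / σ - π' σ) * σ ^ γ = π s) := by
  have hπ : ContinuousOn π (Icc 0 1) := fun s hs => (hderiv s hs).continuousWithinAt
  refine ⟨fun s hs => ?_, fun s hs => ?_⟩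
  · have hg : ContinuousOn (fun t => γ * π t / t) (Ioc 0 1) :=
      ((hπ.mono Ioc_subset_Icc_self).const_mul γ).div continuousOn_id fun x hx => hx.1.ne'
    rw [neg_div]
    exact (hasDerivWithinAt_integral_left_of_continuousOn_Ioc hg hs).sub
      ((hderiv s (Ioc_subset_Icc_self hs)).mono Ioc_subset_Icc_self)
  · have hsub : Icc 0 s ⊆ Icc (0 : ℝ) 1 := Icc_subset_Icc_right hs.2
    rw [integral_commission_mul_rpow hγ.1 hs.1.le (hπ.mono hsub) (fun x hx =>
      (hderiv x (hsub (Ioo_subset_Icc_self hx))).hasDerivAt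
        (Icc_mem_nhds hx.1 (hx.2.trans_le hs.2))) (hcont.mono hsub), neg_mul_neg, ← mul_assoc,
      ← Real.rpow_add hs.1, neg_add_cancel, Real.rpow_zero, one_mul]
end

section
/- Inversion with variable commission: let γ : [0,1] → [0,1] be continuous with γ(s) ≥ c for all s and some constant c > 0, and let π : [0,1] → ℝ be continuously differentiable on [0,1]. Define (K_γπ)(s) = ∫ₛ¹ γ(s')·π(s')/s' ds' − π(s) for s ∈ (0,1]. Then for every s ∈ (0,1], −∫₀ˢ (K_γπ)'(σ) · exp( −∫_σ^s γ(τ)/τ dτ ) dσ = π(s). -/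
open MeasureTheory Set

open Filter Topology

/-- The primitive of `g τ / τ` based at `s > 0` is differentiable on `(0, ∞)`. -/
theorem hasDerivAt_integral_div_id {g : ℝ → ℝ} (hg : Continuous g) {s x : ℝ}
    (hs : 0 < s) (hx : 0 < x) :
    HasDerivAt (fun σ => ∫ τ in s..σ, g τ / τ) (g x / x) x := by
  have hcont : ContinuousOn (fun τ => g τ / τ) (Ioi 0) :=
    hg.continuousOn.div continuousOn_id fun y hy => ne_of_gt hy
  refine intervalIntegral.integral_hasDerivAt_right ?_ ?_ ?_
  · exact (hcont.mono fun y hy => lt_of_lt_of_le (lt_min hs hx) hy.1).intervalIntegrable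
  · exact hcont.stronglyMeasurableAtFilter isOpen_Ioi x hx
  · exact hcont.continuousAt (Ioi_mem_nhds hx)

/-- If `g ≥ c > 0`, the primitive of `g τ / τ` based at `s > 0` tends to `-∞` at `0⁺`. -/
theorem tendsto_integral_div_id_atBot {g : ℝ → ℝ} (hg : Continuous g) {c s : ℝ}
    (hc : 0 < c) (hgc : ∀ x, c ≤ g x) (hs : 0 < s) :
    Tendsto (fun σ => ∫ τ in s..σ, g τ / τ) (𝓝[>] 0) atBot := by
  have hbound : ∀ᶠ σ in 𝓝[>] (0 : ℝ),
      (∫ τ in s..σ, g τ / τ) ≤ c * (Real.log σ + -Real.log s) := by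
    filter_upwards [Ioo_mem_nhdsGT hs] with σ hσ
    have hmono : (∫ τ in σ..s, c * τ⁻¹) ≤ ∫ τ in σ..s, g τ / τ := by
      refine intervalIntegral.integral_mono_on hσ.2.le ?_ ?_ fun τ hτ => ?_
      · refine ContinuousOn.intervalIntegrable_of_Icc hσ.2.le ?_
        exact continuousOn_const.mul
          (continuousOn_id.inv₀ fun y hy => ne_of_gt (hσ.1.trans_le hy.1))
      · refine ContinuousOn.intervalIntegrable_of_Icc hσ.2.le ?_
        exact hg.continuousOn.div continuousOn_id
          fun y hy => ne_of_gt (hσ.1.trans_le hy.1)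
      · rw [div_eq_mul_inv]
        exact mul_le_mul_of_nonneg_right (hgc τ) (inv_nonneg.2 (hσ.1.trans_le hτ.1).le)
    rw [intervalIntegral.integral_const_mul, integral_inv_of_pos hσ.1 hs,
      Real.log_div hs.ne' hσ.1.ne'] at hmono
    rw [intervalIntegral.integral_symm]
    linarith
  refine tendsto_atBot_mono' _ hbound ?_
  exact (tendsto_atBot_add_const_right _ _ Real.tendsto_log_nhdsGT_zero).const_mul_atBot hc

/-- A differentiable function is recovered by integrating `p' + g p / σ` against the kernel
`exp (∫ τ in s..σ, g τ / τ)`, when `g` is bounded below by a positive constant. -/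
theorem integral_add_mul_div_mul_exp_eq {g p p' : ℝ → ℝ} (hg : Continuous g) {c s : ℝ}
    (hc : 0 < c) (hgc : ∀ x, c ≤ g x) (hs : 0 < s) (hp : ContinuousOn p (Icc 0 s))
    (hderiv : ∀ x ∈ Ioo 0 s, HasDerivAt p (p' x) x) (hp' : ContinuousOn p' (Icc 0 s)) :
    ∫ σ in (0 : ℝ)..s, (g σ * p σ / σ + p' σ) * Real.exp (∫ τ in s..σ, g τ / τ) = p s := by
  set E : ℝ → ℝ := Function.update (fun σ => Real.exp (∫ τ in s..σ, g τ / τ)) 0 0 with hE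
  have hE_pos : ∀ x, 0 < x → E x = Real.exp (∫ τ in s..x, g τ / τ) :=
    fun x hx => Function.update_of_ne hx.ne' _ _
  have hE_zero : E 0 = 0 := Function.update_self _ _ _
  have hE_deriv : ∀ x, 0 < x → HasDerivAt E (g x / x * E x) x := fun x hx => by
    rw [hE_pos x hx, mul_comm]
    refine (hasDerivAt_integral_div_id hg hs hx).exp.congr_of_eventuallyEq ?_
    filter_upwards [Ioi_mem_nhds hx] with y hy using hE_pos y hy
  have hE_cont : ContinuousOn E (Icc 0 s) := by
    intro x hx
    rcases hx.1.eq_or_lt with rfl | hx0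
    · have : ContinuousWithinAt E (Ioi 0) 0 := by
        unfold ContinuousWithinAt
        rw [hE_zero]
        refine (Real.tendsto_exp_atBot.comp
          (tendsto_integral_div_id_atBot hg hc hgc hs)).congr' ?_
        filter_upwards [self_mem_nhdsWithin] with y hy using (hE_pos y hy).symm
      exact (continuousWithinAt_Ioi_iff_Ici.1 this).mono Icc_subset_Ici_self
    · exact (hE_deriv x hx0).continuousAt.continuousWithinAt
  have hE_int : IntervalIntegrable (fun x => g x / x * E x) volume 0 s := by
    rw [intervalIntegrable_iff_integrableOn_Ioc_of_le hs.le]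
    refine intervalIntegral.integrableOn_deriv_of_nonneg hE_cont
      (fun x hx => hE_deriv x hx.1) fun x hx => ?_
    rw [hE_pos x hx.1]
    exact mul_nonneg (div_nonneg (hc.le.trans (hgc x)) hx.1.le) (Real.exp_pos _).le
  have hint : IntervalIntegrable (fun x => p' x * E x + p x * (g x / x * E x)) volume 0 s := by
    refine ((hp'.mul hE_cont).intervalIntegrable_of_Icc hs.le).add ?_
    exact hE_int.continuousOn_mul (by rwa [uIcc_of_le hs.le])
  have hftc := intervalIntegral.integral_eq_sub_of_hasDerivAt_of_le hs.le (hp.mul hE_cont)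
    (fun x hx => (hderiv x hx).mul (hE_deriv x hx.1)) hint
  have hE_s : E s = 1 := by simp [hE_pos s hs]
  simp only [Pi.mul_apply, hE_zero, hE_s, mul_one, mul_zero, sub_zero] at hftc
  rw [← hftc]
  refine intervalIntegral.integral_congr_ae (.of_forall fun σ hσ => ?_)
  rw [uIoc_of_le hs.le] at hσ
  rw [hE_pos σ hσ.1]
  ring

/-- **Inversion with variable commission.** For a continuous commission factor
`γ : [0,1] → [0,1]` bounded below by `c > 0` and `π` continuously differentiable on
`[0,1]`, the commission incentive `(K_γπ)(s) = ∫ₛ¹ γ(t)·π(t)/t dt − π(s)` has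
derivative `(K_γπ)'(σ) = −γ(σ)π(σ)/σ − π'(σ)` and satisfies the inversion formula
`−∫₀ˢ (K_γπ)'(σ)·exp(−∫_σ^s γ(τ)/τ dτ) dσ = π(s)` for all `s ∈ (0,1]`. -/
theorem inversion_variable_commission (γ : ℝ → ℝ) (c : ℝ) (hc : 0 < c)
    (hγcont : ContinuousOn γ (Set.Icc (0 : ℝ) 1))
    (hγmem : ∀ s ∈ Set.Icc (0 : ℝ) 1, γ s ∈ Set.Icc (0 : ℝ) 1)
    (hγlb : ∀ s ∈ Set.Icc (0 : ℝ) 1, c ≤ γ s)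
    (π π' : ℝ → ℝ)
    (hderiv : ∀ s ∈ Set.Icc (0 : ℝ) 1, HasDerivWithinAt π (π' s) (Set.Icc (0 : ℝ) 1) s)
    (hcont : ContinuousOn π' (Set.Icc (0 : ℝ) 1)) :
    ∀ s ∈ Set.Ioc (0 : ℝ) 1,
      -∫ σ in (0:ℝ)..s,
          (-(γ σ * π σ) / σ - π' σ) * Real.exp (-∫ τ in σ..s, γ τ / τ) = π s := by
  intro s hs
  set g : ℝ → ℝ := fun x => γ (max 0 (min 1 x)) with hg_def
  have hclamp : ∀ x : ℝ, max 0 (min 1 x) ∈ Icc (0 : ℝ) 1 := fun x =>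
    ⟨le_max_left _ _, max_le zero_le_one (min_le_left _ _)⟩
  have hg : Continuous g := hγcont.comp_continuous (by fun_prop) hclamp
  have hgγ : ∀ x ∈ Icc (0 : ℝ) 1, g x = γ x := fun x hx => by
    simp only [hg_def, min_eq_right hx.2, max_eq_right hx.1]
  have hsub : Icc 0 s ⊆ Icc (0 : ℝ) 1 := Icc_subset_Icc_right hs.2
  rw [← integral_add_mul_div_mul_exp_eq hg hc (fun x => hγlb _ (hclamp x)) hs.1
    (fun x hx => ((hderiv x (hsub hx)).continuousWithinAt.mono hsub))
    (fun x hx => (hderiv x (hsub (Ioo_subset_Icc_self hx))).hasDerivAt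
      (Icc_mem_nhds hx.1 (hx.2.trans_le hs.2))) (hcont.mono hsub),
    ← intervalIntegral.integral_neg]
  refine intervalIntegral.integral_congr_ae (.of_forall fun σ hσ => ?_)
  rw [uIoc_of_le hs.1.le] at hσ
  have hkernel : -∫ τ in σ..s, γ τ / τ = ∫ τ in s..σ, g τ / τ := by
    rw [← intervalIntegral.integral_symm]
    refine intervalIntegral.integral_congr fun τ hτ => ?_
    rw [uIcc_of_ge hσ.2] at hτ
    simp only [hgγ τ ⟨hσ.1.le.trans hτ.1, hτ.2.trans hs.2⟩]
  rw [hkernel, hgγ σ ⟨hσ.1.le, hσ.2.trans hs.2⟩]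
  ring
end

section
/- Closed form of the decision probability for the Weibull(1,2) utility distribution: let μ₀(u) = 2u·e^{−u²} for u > 0 and μ₀(u) = 0 for u ≤ 0, with CDF M₀(x) = 1 − e^{−x²} for x > 0 and M₀(x) = 0 for x ≤ 0. Then for every Δ ≥ 0, ρ(Δ) := ∫₀^∞ μ₀(u)·M₀(u+Δ) du = ∫₀^∞ 2u e^{−u²} (1 − e^{−(u+Δ)²}) du = 1 − (1/2)·e^{−Δ²} + Δ·e^{−Δ²/2}·∫_{Δ/2}^{∞} e^{−2w²} dw. -/
open MeasureTheory Set Real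

/-- The Weibull(1,2) utility density `μ₀(u) = 2u e^{−u²}` on `(0,∞)`. -/
noncomputable def weibullPDF (u : ℝ) : ℝ :=
  if 0 < u then 2 * u * Real.exp (-u ^ 2) else 0

/-- The CDF of the Weibull(1,2) distribution: `M₀(x) = 1 − e^{−x²}` for `x > 0`. -/
noncomputable def weibullCDF (x : ℝ) : ℝ :=
  if 0 < x then 1 - Real.exp (-x ^ 2) else 0

/-- The first moment of a Gaussian over a half-line. -/
theorem integral_Ioi_mul_exp_neg_mul_sq {b : ℝ} (hb : 0 < b) (a : ℝ) :
    ∫ x in Set.Ioi a, x * Real.exp (-b * x ^ 2) = Real.exp (-b * a ^ 2) / (2 * b) := by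
  have hderiv : ∀ x ∈ Set.Ici a, HasDerivAt (fun x : ℝ => -(Real.exp (-b * x ^ 2) / (2 * b)))
      (x * Real.exp (-b * x ^ 2)) x := by
    intro x _
    refine (((hasDerivAt_pow 2 x).const_mul (-b)).exp.div_const (2 * b)).neg.congr_deriv ?_
    push_cast
    field_simp
  have hlim : Filter.Tendsto (fun x : ℝ => -(Real.exp (-b * x ^ 2) / (2 * b)))
      Filter.atTop (nhds 0) := by
    have h : Filter.Tendsto (fun x : ℝ => -b * x ^ 2) Filter.atTop Filter.atBot :=
      (Filter.tendsto_pow_atTop two_ne_zero).const_mul_atTop_of_neg (neg_neg_of_pos hb)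
    simpa using ((Real.tendsto_exp_atBot.comp h).div_const (2 * b)).neg
  rw [integral_Ioi_of_hasDerivAt_of_tendsto' hderiv
    (integrable_mul_exp_neg_mul_sq hb).integrableOn hlim]
  ring

/-- Translation of an integral over a half-line. -/
theorem setIntegral_Ioi_zero_comp_add_right (f : ℝ → ℝ) (c : ℝ) :
    ∫ x in Set.Ioi (0 : ℝ), f (x + c) = ∫ x in Set.Ioi c, f x := by
  have h := (measurePreserving_add_right (volume : Measure ℝ) c).setIntegral_preimage_emb
    (measurableEmbedding_addRight c) f (Set.Ioi c)
  simpa using h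

/-- Completing the square in the product of two shifted Gaussians. -/
theorem exp_neg_sq_mul_exp_neg_add_sq (u d : ℝ) :
    Real.exp (-u ^ 2) * Real.exp (-(u + d) ^ 2) =
      Real.exp (-d ^ 2 / 2) * Real.exp (-2 * (u + d / 2) ^ 2) := by
  rw [← Real.exp_add, ← Real.exp_add]
  ring_nf

/-- **Closed form of the decision probability for the Weibull(1,2) utility
distribution.** For every `Δ ≥ 0`,
`ρ(Δ) = ∫₀^∞ μ₀(u)·M₀(u+Δ) du = ∫₀^∞ 2u e^{−u²}(1 − e^{−(u+Δ)²}) du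
      = 1 − (1/2)e^{−Δ²} + Δ e^{−Δ²/2} ∫_{Δ/2}^∞ e^{−2w²} dw`. -/
theorem weibull_decision_probability (Δ : ℝ) (hΔ : 0 ≤ Δ) :
    (∫ u in Set.Ioi (0:ℝ), weibullPDF u * weibullCDF (u + Δ)) =
      (∫ u in Set.Ioi (0:ℝ), 2 * u * Real.exp (-u ^ 2) * (1 - Real.exp (-(u + Δ) ^ 2))) ∧
    (∫ u in Set.Ioi (0:ℝ), 2 * u * Real.exp (-u ^ 2) * (1 - Real.exp (-(u + Δ) ^ 2))) =
      1 - (1 / 2) * Real.exp (-Δ ^ 2) +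
        Δ * Real.exp (-Δ ^ 2 / 2) * ∫ w in Set.Ioi (Δ / 2), Real.exp (-2 * w ^ 2) := by
  constructor
  · refine setIntegral_congr_fun measurableSet_Ioi fun u hu => ?_
    have hu : 0 < u := hu
    simp only [weibullPDF, weibullCDF, if_pos hu, if_pos (add_pos_of_pos_of_nonneg hu hΔ)]
  · have hsplit : ∀ u : ℝ, 2 * u * Real.exp (-u ^ 2) * (1 - Real.exp (-(u + Δ) ^ 2)) =
        2 * (u * Real.exp (-1 * u ^ 2)) -
          2 * Real.exp (-Δ ^ 2 / 2) * ((u + Δ / 2) * Real.exp (-2 * (u + Δ / 2) ^ 2)) +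
          Δ * Real.exp (-Δ ^ 2 / 2) * Real.exp (-2 * (u + Δ / 2) ^ 2) := by
      intro u
      rw [neg_one_mul]
      linear_combination (-2 * u) * exp_neg_sq_mul_exp_neg_add_sq u Δ
    have hint₁ : IntegrableOn (fun u : ℝ => 2 * (u * Real.exp (-1 * u ^ 2))) (Set.Ioi 0) :=
      ((integrable_mul_exp_neg_mul_sq one_pos).const_mul 2).integrableOn
    have hint₂ : IntegrableOn (fun u : ℝ => 2 * Real.exp (-Δ ^ 2 / 2) *
        ((u + Δ / 2) * Real.exp (-2 * (u + Δ / 2) ^ 2))) (Set.Ioi 0) :=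
      (((integrable_mul_exp_neg_mul_sq two_pos).comp_add_right (Δ / 2)).const_mul _).integrableOn
    have hint₃ : IntegrableOn (fun u : ℝ => Δ * Real.exp (-Δ ^ 2 / 2) *
        Real.exp (-2 * (u + Δ / 2) ^ 2)) (Set.Ioi 0) :=
      (((integrable_exp_neg_mul_sq two_pos).comp_add_right (Δ / 2)).const_mul _).integrableOn
    have hint₁₂ : IntegrableOn (fun u : ℝ => 2 * (u * Real.exp (-1 * u ^ 2)) -
        2 * Real.exp (-Δ ^ 2 / 2) * ((u + Δ / 2) * Real.exp (-2 * (u + Δ / 2) ^ 2)))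
        (Set.Ioi 0) := hint₁.sub hint₂
    simp only [hsplit]
    rw [integral_add hint₁₂ hint₃, integral_sub hint₁ hint₂,
      integral_const_mul, integral_const_mul, integral_const_mul,
      setIntegral_Ioi_zero_comp_add_right (fun x => x * Real.exp (-2 * x ^ 2)),
      setIntegral_Ioi_zero_comp_add_right (fun x => Real.exp (-2 * x ^ 2)),
      integral_Ioi_mul_exp_neg_mul_sq one_pos, integral_Ioi_mul_exp_neg_mul_sq two_pos]
    have hexp : Real.exp (-Δ ^ 2 / 2) * Real.exp (-2 * (Δ / 2) ^ 2) = Real.exp (-Δ ^ 2) := by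
      rw [← Real.exp_add]
      ring_nf
    rw [← hexp]
    norm_num
    ring
end
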